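/- Let K > 0, let B ⊂ ℝ^d be a ball, and let Q be a finite set of cubes Q with ℓ(Q) ≥ K·diam(B). Then ∂(∪Q) ∩ B is a union of at most C_d (K^{−d} + 1) Lipschitz surfaces whose Lipschitz constants depend only on the dimension, and H^{d−1}( ∂(∪Q) ∩ B ) ≤ C_d (K^{−d} + 1) H^{d−1}(∂B), where C_d depends only on the dimension d. -/

import Mathlib

open MeasureTheory Metric Set Filter
open scoped ENNReal NNReal Topology

noncomputable section

/-- Euclidean space `ℝ^d`. -/
abbrev Euc (d : ℕ) := EuclideanSpace ℝ (Fin d)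

/-- The divergence of a vector field `φ : ℝ^d → ℝ^d`. -/
def diverg (d : ℕ) (φ : Euc d → Euc d) (x : Euc d) : ℝ :=
  ∑ i : Fin d, fderiv ℝ φ x (EuclideanSpace.single i 1) i

/-- The variation of `f` on an open set `Ω`:
`var_Ω f = sup { ∫_Ω f div φ : φ ∈ C_c^1(Ω; ℝ^d), |φ| ≤ 1 }`. -/
def variation (d : ℕ) (Ω : Set (Euc d)) (f : Euc d → ℝ) : ℝ≥0∞ :=
  ⨆ (φ : Euc d → Euc d) (_ : ContDiff ℝ 1 φ) (_ : HasCompactSupport φ)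
    (_ : tsupport φ ⊆ Ω) (_ : ∀ x, ‖φ x‖ ≤ 1),
    ENNReal.ofReal (∫ x in Ω, f x * diverg d φ x)

/-- `Q` is a cube of side length `l`: the image of `(0,1)^d` scaled by `l`,
rotated and translated. -/
def IsCubeOfSide (d : ℕ) (l : ℝ) (Q : Set (Euc d)) : Prop :=
  0 < l ∧ ∃ (r : Euc d ≃ₗᵢ[ℝ] Euc d) (v : Euc d),
    Q = (fun x => l • r x + v) '' {x : Euc d | ∀ i, x i ∈ Set.Ioo (0:ℝ) 1}

/-- `Q` is a cube (of some positive side length, arbitrary orientation). -/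
def IsCube (d : ℕ) (Q : Set (Euc d)) : Prop := ∃ l, IsCubeOfSide d l Q

/-- The side length of a cube, recovered from its volume. -/
def sideLength (d : ℕ) (Q : Set (Euc d)) : ℝ := (volume Q).toReal ^ ((d:ℝ)⁻¹)

/-- The center of a cube, recovered as its barycenter. -/
def cubeCenter (d : ℕ) (Q : Set (Euc d)) : Euc d := (volume Q).toReal⁻¹ • ∫ x in Q, x

/-- The dilate `KQ = {c_Q + K r : c_Q + r ∈ Q}` of a cube `Q` about its center. -/
def dilate (d : ℕ) (K : ℝ) (Q : Set (Euc d)) : Set (Euc d) :=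
  {y | ∃ x ∈ Q, y = cubeCenter d Q + K • (x - cubeCenter d Q)}

/-- `Q ∈ Δ(Q0)`: `Q` is a dyadic subcube of the cube `Q0`, i.e. the image under the
affine bijection mapping `(0,1)^d` onto `Q0` of a dyadic subcube of `(0,1)^d`. -/
def IsDyadicOf (d : ℕ) (Q Q0 : Set (Euc d)) : Prop :=
  ∃ (l : ℝ) (r : Euc d ≃ₗᵢ[ℝ] Euc d) (v : Euc d), 0 < l ∧
    Q0 = (fun x => l • r x + v) '' {x : Euc d | ∀ i, x i ∈ Set.Ioo (0:ℝ) 1} ∧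
    ∃ (n : ℕ) (k : Fin d → ℕ), (∀ i, k i < 2 ^ n) ∧
      Q = (fun x => l • r x + v) ''
        {x : Euc d | ∀ i, x i ∈ Set.Ioo ((k i : ℝ) / 2 ^ n) (((k i : ℝ) + 1) / 2 ^ n)}

/-- A set of cubes is dyadically complete if for all `Q0, P` in it with `P ⊆ Q0`,
every dyadic cube `Q ∈ Δ(Q0)` with `P ⊆ Q` also belongs to it. -/
def DyadicComplete (d : ℕ) (𝒬 : Set (Set (Euc d))) : Prop :=
  ∀ Q0 ∈ 𝒬, ∀ P ∈ 𝒬, P ⊆ Q0 → ∀ Q, IsDyadicOf d Q Q0 → P ⊆ Q → Q ∈ 𝒬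

/-- The measure theoretic closure `cl* E = {x : limsup_{r→0} |B(x,r)∩E|/r^d > 0}`. -/
def mClosure (d : ℕ) (E : Set (Euc d)) : Set (Euc d) :=
  {x | 0 < Filter.limsup (fun r : ℝ => volume (Metric.ball x r ∩ E) / ENNReal.ofReal (r ^ d))
      (nhdsWithin 0 (Set.Ioi 0))}

/-- The measure theoretic boundary `∂* E = cl* E ∩ cl* (Eᶜ)`. -/
def mBoundary (d : ℕ) (E : Set (Euc d)) : Set (Euc d) := mClosure d E ∩ mClosure d Eᶜ

/-- `E` has locally finite perimeter: the variation of its indicator function is finite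
on every bounded open set. -/
def HasLocallyFinitePerimeter (d : ℕ) (E : Set (Euc d)) : Prop :=
  ∀ V : Set (Euc d), IsOpen V → Bornology.IsBounded V →
    variation d V (Set.indicator E fun _ => (1:ℝ)) < ⊤

/-- The integral average `f_Q = |Q|⁻¹ ∫_Q f`. -/
def avg (d : ℕ) (f : Euc d → ℝ) (Q : Set (Euc d)) : ℝ :=
  (volume Q).toReal⁻¹ * ∫ x in Q, f x

/-- The point of `ℝ^d` obtained from `u ∈ ℝ^{d-1}` and the graph value `f u` in the
last coordinate. -/
def graphPoint (d : ℕ) (f : Euc (d-1) → ℝ) (u : Euc (d-1)) : Euc d :=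
  (EuclideanSpace.equiv (Fin d) ℝ).symm
    (fun j => if h : (j : ℕ) < d - 1 then u ⟨(j : ℕ), h⟩ else f u)

/-- `S ⊆ ℝ^d` is a Lipschitz surface with constant `L`: a rotation and translation
(rigid motion) of the graph `{(x, f x) : x ∈ U}` of a function `f : U → ℝ`,
`U ⊆ ℝ^{d-1}`, which is Lipschitz with constant `L`. -/
def IsLipschitzSurface (d : ℕ) (L : ℝ) (S : Set (Euc d)) : Prop :=
  ∃ (U : Set (Euc (d-1))) (f : Euc (d-1) → ℝ) (g : Euc d ≃ᵢ Euc d),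
    LipschitzOnWith (Real.toNNReal L) f U ∧ S = g '' (graphPoint d f '' U)

/-- The projection of `ℝ^{m+1}` onto its first `m` coordinates. -/
def coordProj (m : ℕ) (x : Euc (m + 1)) : Euc m := WithLp.toLp 2 fun i => x i.castSucc

theorem dist_sq_eq_coordProj {m : ℕ} (x y : Euc (m + 1)) :
    dist x y ^ 2 = dist (coordProj m x) (coordProj m y) ^ 2
      + (x (Fin.last m) - y (Fin.last m)) ^ 2 := by
  rw [EuclideanSpace.dist_sq_eq, EuclideanSpace.dist_sq_eq, Fin.sum_univ_castSucc]
  simp [coordProj, Real.dist_eq, sq_abs]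

theorem lipschitzWith_coordProj (m : ℕ) : LipschitzWith 1 (coordProj m) := by
  refine LipschitzWith.of_dist_le_mul fun x y => ?_
  have h := dist_sq_eq_coordProj x y
  rw [NNReal.coe_one, one_mul]
  exact abs_le_of_sq_le_sq' (by nlinarith [sq_nonneg (x (Fin.last m) - y (Fin.last m))])
    dist_nonneg |>.2

theorem coordProj_graphPoint {m : ℕ} (f : Euc m → ℝ) (u : Euc m) :
    coordProj m (graphPoint (m + 1) f u) = u := by
  ext i
  simp [coordProj, graphPoint]

theorem graphPoint_last {m : ℕ} (f : Euc m → ℝ) (u : Euc m) :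
    graphPoint (m + 1) f u (Fin.last m) = f u := by
  simp [graphPoint]

theorem graphPoint_coordProj {m : ℕ} (f : Euc m → ℝ) (x : Euc (m + 1))
    (h : f (coordProj m x) = x (Fin.last m)) : graphPoint (m + 1) f (coordProj m x) = x := by
  apply dist_le_zero.1
  have := dist_sq_eq_coordProj (graphPoint (m + 1) f (coordProj m x)) x
  rw [coordProj_graphPoint, graphPoint_last, h] at this
  nlinarith [dist_nonneg (x := graphPoint (m + 1) f (coordProj m x)) (y := x), dist_self (coordProj m x)]

/-- A linear isometry straightening a given unit vector to the last coordinate direction. -/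
theorem exists_linearIsometryEquiv_last {m : ℕ} (n : Euc (m + 1)) (hn : ‖n‖ = 1) :
    ∃ g : Euc (m + 1) ≃ₗᵢ[ℝ] Euc (m + 1), ∀ z, g z (Fin.last m) = inner ℝ z n := by
  let e : Euc (m + 1) := EuclideanSpace.single (Fin.last m) 1
  have he : ‖n‖ = ‖e‖ := by simp [e, hn]
  refine ⟨(ℝ ∙ (n - e))ᗮ.reflection, fun z => ?_⟩
  rw [← ((ℝ ∙ (n - e))ᗮ.reflection).inner_map_map z n, Submodule.reflection_sub he]
  simp [e, EuclideanSpace.inner_single_right]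

/-- A set whose chords all avoid a circular cone is a Lipschitz surface. -/
theorem isLipschitzSurface_of_inner_le {m : ℕ} (S : Set (Euc (m + 1))) (n : Euc (m + 1))
    (hn : ‖n‖ = 1) {a : ℝ} (ha : 1 ≤ a)
    (hS : ∀ x ∈ S, ∀ y ∈ S, inner ℝ (y - x) n ≤ (1 - 1 / a) * ‖y - x‖) :
    IsLipschitzSurface (m + 1) a S := by
  obtain ⟨g, hg⟩ := exists_linearIsometryEquiv_last n hn
  have ha0 : 0 < a := by linarith
  have key : ∀ x ∈ S, ∀ y ∈ S, |g x (Fin.last m) - g y (Fin.last m)| ≤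
      a * dist (coordProj m (g x)) (coordProj m (g y)) := by
    intro x hx y hy
    have h1 := hS x hx y hy
    have h2 := hS y hy x hx
    have hd := dist_sq_eq_coordProj (g x) (g y)
    have hdg : dist (g x) (g y) = ‖y - x‖ := by rw [g.dist_map, dist_comm, dist_eq_norm]
    rw [hdg] at hd
    rw [← norm_neg, neg_sub] at h2
    rw [hg x, hg y] at hd ⊢
    rw [inner_sub_left] at h1 h2
    set p := dist (coordProj m (g x)) (coordProj m (g y))
    set t := inner ℝ x n - inner ℝ y n
    have hp : 0 ≤ p := dist_nonneg
    have hq : 0 ≤ ‖y - x‖ := norm_nonneg _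
    have hc0 : 0 ≤ 1 - 1 / a := by
      rw [sub_nonneg, div_le_one ha0]; exact ha
    have hc1 : (1 - 1 / a) ^ 2 ≤ 1 - 1 / a := by
      have : 0 ≤ 1 / a := by positivity
      nlinarith
    have habs : |t| ≤ (1 - 1 / a) * ‖y - x‖ := abs_le.2 ⟨by linarith, by linarith⟩
    have hsq : t ^ 2 ≤ (1 - 1 / a) * (p ^ 2 + t ^ 2) := by
      have : t ^ 2 ≤ ((1 - 1 / a) * ‖y - x‖) ^ 2 := by
        rw [← sq_abs]; gcongr
      rw [mul_pow, hd] at this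
      exact this.trans (by gcongr)
    have hmul : t ^ 2 ≤ (a - 1) * p ^ 2 := by
      have : a * t ^ 2 ≤ a * ((1 - 1 / a) * (p ^ 2 + t ^ 2)) := by gcongr
      have h3 : a * ((1 - 1 / a) * (p ^ 2 + t ^ 2)) = (a - 1) * (p ^ 2 + t ^ 2) := by
        field_simp
      nlinarith
    refine abs_le_of_sq_le_sq ?_ (by positivity)
    nlinarith [sq_nonneg p, mul_nonneg (mul_nonneg (sub_nonneg.2 ha) ha0.le) (sq_nonneg p)]
  let P : Euc (m + 1) → Euc m := fun x => coordProj m (g x)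
  let f : Euc m → ℝ := fun u => g (Function.invFunOn P S u) (Fin.last m)
  have hinv : ∀ x ∈ S, Function.invFunOn P S (P x) ∈ S ∧ P (Function.invFunOn P S (P x)) = P x :=
    fun x hx => ⟨Function.invFunOn_mem ⟨x, hx, rfl⟩, Function.invFunOn_eq ⟨x, hx, rfl⟩⟩
  have hf : ∀ x ∈ S, f (P x) = g x (Fin.last m) := by
    intro x hx
    have := key _ (hinv x hx).1 x hx
    change _ ≤ a * dist (P _) (P _) at this
    rw [(hinv x hx).2, dist_self, mul_zero] at this
    exact sub_eq_zero.1 (abs_nonpos_iff.1 this)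
  refine ⟨P '' S, f, g.symm.toIsometryEquiv, ?_, ?_⟩
  · refine LipschitzOnWith.of_dist_le_mul ?_
    rintro _ ⟨x, hx, rfl⟩ _ ⟨y, hy, rfl⟩
    rw [hf x hx, hf y hy, Real.coe_toNNReal _ ha0.le]
    exact key x hx y hy
  · rw [image_image, image_image]
    have : ∀ x ∈ S, g.symm.toIsometryEquiv (graphPoint (m + 1) f (P x)) = x := by
      intro x hx
      rw [graphPoint_coordProj f (g x) (hf x hx)]
      exact g.symm_apply_apply x
    rw [image_congr this, image_id']

theorem ball_subset_coordProj_image_sphere {m : ℕ} (c : Euc (m + 1)) {R : ℝ} :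
    ball (coordProj m c) R ⊆ coordProj m '' sphere c R := by
  intro u hu
  rw [mem_ball] at hu
  have hR : 0 ≤ R := dist_nonneg.trans hu.le
  let f : Euc m → ℝ := fun _ => c (Fin.last m) + √(R ^ 2 - dist u (coordProj m c) ^ 2)
  refine ⟨graphPoint (m + 1) f u, ?_, coordProj_graphPoint f u⟩
  rw [mem_sphere, ← sq_eq_sq₀ dist_nonneg hR, dist_sq_eq_coordProj, coordProj_graphPoint,
    graphPoint_last]
  simp only [f, add_sub_cancel_left]
  rw [Real.sq_sqrt]
  · ring
  · rw [sub_nonneg]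
    gcongr

theorem IsLipschitzSurface.hausdorffMeasure_le {m : ℕ} {L : ℝ} (hL : 0 ≤ L)
    {S : Set (Euc (m + 1))} (hS : IsLipschitzSurface (m + 1) L S) {c : Euc (m + 1)} {R : ℝ}
    (hSc : S ⊆ ball c R) :
    μH[(m : ℝ)] S ≤ ENNReal.ofReal ((1 + L) ^ m) * μH[(m : ℝ)] (sphere c R) := by
  obtain ⟨U, f, g, hf, rfl⟩ := hS
  have hlip : LipschitzOnWith (Real.toNNReal (1 + L)) (graphPoint (m + 1) f) U := by
    refine LipschitzOnWith.of_dist_le_mul fun x hx y hy => ?_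
    have h1 := hf.dist_le_mul x hx y hy
    rw [Real.coe_toNNReal _ hL, Real.dist_eq] at h1
    rw [Real.coe_toNNReal _ (by linarith)]
    have h2 := dist_sq_eq_coordProj (graphPoint (m + 1) f x) (graphPoint (m + 1) f y)
    rw [coordProj_graphPoint, coordProj_graphPoint, graphPoint_last, graphPoint_last,
      ← sq_abs (f x - f y)] at h2
    have h0 : 0 ≤ dist x y := dist_nonneg
    refine abs_le_of_sq_le_sq' ?_ (by positivity) |>.2
    have h3 : |f x - f y| ^ 2 ≤ (L * dist x y) ^ 2 := by gcongr
    nlinarith [mul_nonneg hL (sq_nonneg (dist x y))]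
  have hU : U ⊆ ball (coordProj m (g.symm c)) R := by
    intro u hu
    have h1 := hSc ⟨_, ⟨u, hu, rfl⟩, rfl⟩
    rw [mem_ball, ← g.symm.dist_eq, g.symm_apply_apply] at h1
    have h2 := (lipschitzWith_coordProj m).dist_le_mul (graphPoint (m + 1) f u) (g.symm c)
    rw [coordProj_graphPoint, NNReal.coe_one, one_mul] at h2
    exact h2.trans_lt h1
  have hm : (0 : ℝ) ≤ m := m.cast_nonneg
  have hpow : ((Real.toNNReal (1 + L) : ℝ≥0) : ℝ≥0∞) ^ (m : ℝ) = ENNReal.ofReal ((1 + L) ^ m) := by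
    rw [ENNReal.rpow_natCast, ENNReal.ofReal_pow (by linarith)]
    rfl
  rw [g.hausdorffMeasure_image]
  calc μH[(m : ℝ)] (graphPoint (m + 1) f '' U)
      ≤ _ := hlip.hausdorffMeasure_image_le hm
    _ = ENNReal.ofReal ((1 + L) ^ m) * μH[(m : ℝ)] U := by rw [hpow]
    _ ≤ ENNReal.ofReal ((1 + L) ^ m) * μH[(m : ℝ)] (coordProj m '' sphere (g.symm c) R) := by
        gcongr
        exact hU.trans (ball_subset_coordProj_image_sphere _)
    _ ≤ ENNReal.ofReal ((1 + L) ^ m) * μH[(m : ℝ)] (sphere (g.symm c) R) := by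
        gcongr
        simpa using (lipschitzWith_coordProj m).hausdorffMeasure_image_le hm (sphere (g.symm c) R)
    _ = _ := by
        rw [← g.hausdorffMeasure_image, g.image_sphere, g.apply_symm_apply]

/-- A circular cone around `n` lies in the orthant spanned by unit vectors making equal angles
with a direction `u` close to `n`. -/
theorem inner_pos_of_mem_cone {E : Type*} [NormedAddCommGroup E] [InnerProductSpace ℝ E]
    {s : ℝ} (hs : 0 < s) {n u v w : E} (hn : ‖n‖ = 1) (hv : ‖v‖ = 1) (huv : inner ℝ u v = 1 / s)
    (hnu : ‖n - u‖ ≤ 1 / (2 * s)) (hw : (1 - 1 / (8 * s ^ 2)) * ‖w‖ < inner ℝ w n) :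
    0 < inner ℝ w v := by
  have hb : 0 < ‖w‖ := by
    rw [norm_pos_iff]
    rintro rfl
    simp at hw
  have h1 : ‖w - ‖w‖ • n‖ < ‖w‖ * (1 / (2 * s)) := by
    refine lt_of_pow_lt_pow_left₀ 2 (by positivity) ?_
    rw [norm_sub_sq_real, norm_smul, hn, real_inner_smul_right, norm_norm]
    have h : ‖w‖ * ((1 - 1 / (8 * s ^ 2)) * ‖w‖) < ‖w‖ * inner ℝ w n := by gcongr
    have h' : (‖w‖ * (1 / (2 * s))) ^ 2 = 2 * (‖w‖ * (1 / (8 * s ^ 2) * ‖w‖)) := by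
      field_simp; ring
    rw [h']
    nlinarith
  have h2 : ‖w - ‖w‖ • u‖ < ‖w‖ * (1 / s) := by
    have : w - ‖w‖ • u = (w - ‖w‖ • n) + ‖w‖ • (n - u) := by rw [smul_sub]; abel
    rw [this]
    have h3 : ‖‖w‖ • (n - u)‖ ≤ ‖w‖ * (1 / (2 * s)) := by
      rw [norm_smul, norm_norm]; gcongr
    have h4 : ‖w‖ * (1 / s) = ‖w‖ * (1 / (2 * s)) + ‖w‖ * (1 / (2 * s)) := by ring
    rw [h4]
    exact (norm_add_le _ _).trans_lt (add_lt_add_of_lt_of_le h1 h3)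
  have h5 : inner ℝ w v = ‖w‖ * (1 / s) + inner ℝ (w - ‖w‖ • u) v := by
    rw [inner_sub_left, real_inner_smul_left, huv]; ring
  have h6 := neg_le_of_abs_le (abs_real_inner_le_norm (w - ‖w‖ • u) v)
  rw [hv, mul_one] at h6
  linarith

theorem IsCubeOfSide.eq_setOf {d : ℕ} {l : ℝ} {Q : Set (Euc d)} (hQ : IsCubeOfSide d l Q) :
    ∃ (r : Euc d ≃ₗᵢ[ℝ] Euc d) (v : Euc d),
      Q = {x | ∀ i, r.symm (x - v) i ∈ Ioo 0 l} := by
  obtain ⟨hl, r, v, rfl⟩ := hQ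
  refine ⟨r, v, ?_⟩
  ext x
  constructor
  · rintro ⟨z, hz, rfl⟩ i
    have := hz i
    simp only [add_sub_cancel_right, map_smul, LinearIsometryEquiv.symm_apply_apply,
      PiLp.smul_apply, smul_eq_mul, mem_Ioo] at this ⊢
    exact ⟨mul_pos hl this.1, by nlinarith⟩
  · intro hx
    refine ⟨l⁻¹ • r.symm (x - v), fun i => ?_, ?_⟩
    · have := hx i
      simp only [PiLp.smul_apply, smul_eq_mul, mem_Ioo] at this ⊢
      exact ⟨mul_pos (inv_pos.2 hl) this.1, by rw [inv_mul_lt_one₀ hl]; exact this.2⟩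
    · simp [smul_smul, hl.ne']

theorem IsCubeOfSide.isOpen {d : ℕ} {l : ℝ} {Q : Set (Euc d)} (hQ : IsCubeOfSide d l Q) :
    IsOpen Q := by
  obtain ⟨r, v, rfl⟩ := hQ.eq_setOf
  rw [ofPred_forall]
  refine isOpen_iInter_of_finite fun i => ?_
  exact isOpen_Ioo.preimage (f := fun x : Euc d => r.symm (x - v) i) (by fun_prop)

/-- Near a point of its closure, a cube contains an orthant with that point as apex. -/
theorem IsCubeOfSide.exists_orthant {d : ℕ} {l : ℝ} {Q : Set (Euc d)} (hQ : IsCubeOfSide d l Q)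
    (hd : 0 < d) {x : Euc d} (hx : x ∈ closure Q) :
    ∃ (u : Euc d) (e : Fin d → Euc d), ‖u‖ = 1 ∧ (∀ i, ‖e i‖ = 1 ∧ inner ℝ u (e i) = 1 / √d) ∧
      ∀ y, dist y x < l / 2 → (∀ i, 0 < inner ℝ (y - x) (e i)) → y ∈ Q := by
  obtain ⟨r, v, rfl⟩ := hQ.eq_setOf
  have hl := hQ.1
  have hx' : ∀ i, r.symm (x - v) i ∈ Icc 0 l := by
    intro i
    have hcl : IsClosed {x : Euc d | r.symm (x - v) i ∈ Icc 0 l} :=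
      isClosed_Icc.preimage (f := fun x : Euc d => r.symm (x - v) i) (by fun_prop)
    have hsub : {x : Euc d | ∀ i, r.symm (x - v) i ∈ Ioo 0 l} ⊆
        {x : Euc d | r.symm (x - v) i ∈ Icc 0 l} := fun z hz => Ioo_subset_Icc_self (hz i)
    exact closure_minimal hsub hcl hx
  let σ : Fin d → ℝ := fun i => if r.symm (x - v) i ≤ l / 2 then 1 else -1
  have hσ : ∀ i, σ i * σ i = 1 := by intro i; dsimp only [σ]; split_ifs <;> norm_num
  have hσ' : ∀ i, |σ i| = 1 := by intro i; dsimp only [σ]; split_ifs <;> norm_num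
  have hd' : (0 : ℝ) < d := by exact_mod_cast hd
  have hsd : 0 < √(d : ℝ) := Real.sqrt_pos.2 hd'
  refine ⟨r ((√d)⁻¹ • WithLp.toLp 2 σ), fun i => r (EuclideanSpace.single i (σ i)), ?_,
    fun i => ⟨?_, ?_⟩, ?_⟩
  · have : ‖(WithLp.toLp 2 σ : Euc d)‖ = √d := by
      rw [EuclideanSpace.norm_eq]
      simp [hσ']
    rw [r.norm_map, norm_smul, this, norm_inv, Real.norm_of_nonneg hsd.le, inv_mul_cancel₀ hsd.ne']
  · rw [r.norm_map]; simp [hσ']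
  · rw [r.inner_map_map, real_inner_smul_left, EuclideanSpace.inner_single_right]
    simp [hσ]
  · intro y hy h i
    have h1 := h i
    rw [← r.symm.inner_map_map, r.symm_apply_apply, EuclideanSpace.inner_single_right] at h1
    have h2 : |r.symm (y - x) i| < l / 2 := by
      refine lt_of_le_of_lt ?_ hy
      rw [dist_eq_norm, ← r.symm.norm_map]
      exact PiLp.norm_apply_le (r.symm (y - x)) i
    have h3 : r.symm (y - v) i = r.symm (y - x) i + r.symm (x - v) i := by
      rw [← PiLp.add_apply, ← map_add, sub_add_sub_cancel]
    have h4 := abs_lt.1 h2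
    have h5 := hx' i
    simp only [mem_Icc] at h5
    rw [h3]
    dsimp only [σ] at h1
    split_ifs at h1 with hc
    · rw [conj_trivial, one_mul] at h1
      constructor <;> linarith
    · rw [conj_trivial, neg_one_mul] at h1
      constructor <;> linarith

/-- A boundary point of a union of cubes is the apex of a truncated cone contained in the union,
with axis in a prescribed net of the unit sphere. -/
theorem exists_cone_of_mem_frontier {d : ℕ} (hd : 0 < d) {t : Set (Euc d)}
    (ht1 : ∀ n ∈ t, ‖n‖ = 1) (ht : ∀ u : Euc d, ‖u‖ = 1 → ∃ n ∈ t, ‖n - u‖ ≤ 1 / (2 * √d))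
    {ρ : ℝ} {𝒬 : Set (Set (Euc d))} (h𝒬 : 𝒬.Finite)
    (hside : ∀ Q ∈ 𝒬, ∃ l, IsCubeOfSide d l Q ∧ ρ ≤ l / 2) {x : Euc d}
    (hx : x ∈ frontier (⋃₀ 𝒬)) :
    ∃ n ∈ t, ∀ y, dist y x < ρ → (1 - 1 / (8 * d)) * ‖y - x‖ < inner ℝ (y - x) n → y ∈ ⋃₀ 𝒬 := by
  have hx' := frontier_subset_closure hx
  rw [h𝒬.closure_sUnion] at hx'
  simp only [mem_iUnion] at hx'
  obtain ⟨Q, hQ, hxQ⟩ := hx'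
  obtain ⟨l, hQl, hρ⟩ := hside Q hQ
  obtain ⟨u, e, hu, he, hcone⟩ := hQl.exists_orthant hd hxQ
  obtain ⟨n, hn, hnu⟩ := ht u hu
  refine ⟨n, hn, fun y hy hyn => ⟨Q, hQ, hcone y (hy.trans_le hρ) fun i => ?_⟩⟩
  have hd' : (0 : ℝ) < d := by exact_mod_cast hd
  refine inner_pos_of_mem_cone (Real.sqrt_pos.2 hd') (ht1 n hn) (he i).1 (he i).2 hnu ?_
  rwa [Real.sq_sqrt hd'.le]

theorem exists_finset_net_sphere (d : ℕ) {δ : ℝ} (hδ : 0 < δ) :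
    ∃ t : Finset (Euc d), (∀ n ∈ t, ‖n‖ = 1) ∧
      ∀ u : Euc d, ‖u‖ = 1 → ∃ n ∈ t, ‖n - u‖ ≤ δ := by
  obtain ⟨t, hts, htf, hcov⟩ := finite_cover_balls_of_compact (isCompact_sphere (0 : Euc d) 1) hδ
  refine ⟨htf.toFinset, fun n hn => ?_, fun u hu => ?_⟩
  · simpa using hts (htf.mem_toFinset.1 hn)
  · have := hcov (show u ∈ sphere (0 : Euc d) 1 by simpa using hu)
    simp only [mem_iUnion] at this
    obtain ⟨n, hn, hun⟩ := this
    refine ⟨n, htf.mem_toFinset.2 hn, ?_⟩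
    rw [mem_ball, dist_comm, dist_eq_norm] at hun
    exact hun.le

/-- Two points in the same cell of a grid of mesh `h` are at distance at most `h √d`. -/
theorem dist_le_of_floor_eq {d : ℕ} {h : ℝ} (hh : 0 < h) {x y c : Euc d}
    (hxy : ∀ i, ⌊(x i - c i) / h⌋ = ⌊(y i - c i) / h⌋) : dist x y ≤ h * √d := by
  rw [EuclideanSpace.dist_eq]
  refine (Real.sqrt_le_sqrt (y := h ^ 2 * d) ?_).trans_eq ?_
  · calc ∑ i, dist (x i) (y i) ^ 2 ≤ ∑ _i : Fin d, h ^ 2 := by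
          refine Finset.sum_le_sum fun i _ => ?_
          have h1 := Int.abs_sub_lt_one_of_floor_eq_floor (hxy i)
          rw [← sub_div, sub_sub_sub_cancel_right, abs_div, abs_of_pos hh, div_lt_one hh] at h1
          rw [Real.dist_eq]
          gcongr
      _ = h ^ 2 * d := by simp [mul_comm]
  · rw [Real.sqrt_mul (by positivity), Real.sqrt_sq hh.le]

theorem floor_mem_Icc_of_mem_ball {d : ℕ} {h R : ℝ} (hh : 0 < h) {x c : Euc d}
    (hx : x ∈ ball c R) (i : Fin d) :
    ⌊(x i - c i) / h⌋ ∈ Finset.Icc (-(⌈R / h⌉₊ : ℤ)) ⌈R / h⌉₊ := by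
  have h1 : |x i - c i| ≤ R := by
    rw [mem_ball, dist_eq_norm] at hx
    exact (PiLp.norm_apply_le (x - c) i).trans hx.le
  have h2 : |(x i - c i) / h| ≤ ⌈R / h⌉₊ := by
    rw [abs_div, abs_of_pos hh]
    exact (div_le_div_of_nonneg_right h1 hh.le).trans (Nat.le_ceil _)
  rw [abs_le] at h2
  rw [Finset.mem_Icc]
  constructor
  · rw [Int.le_floor]; push_cast; exact h2.1
  · rw [← Int.cast_le (R := ℝ)]
    exact (Int.floor_le _).trans (by exact_mod_cast h2.2)

theorem grid_card_le {d : ℕ} {a K : ℝ} (ha : 0 ≤ a) (hK : 0 < K) :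
    ((2 * ⌈a / K⌉₊ + 1 : ℕ) : ℝ) ^ d ≤ 2 ^ (d - 1) * ((2 * a) ^ d + 3 ^ d) * (K⁻¹ ^ d + 1) := by
  have h1 : ((2 * ⌈a / K⌉₊ + 1 : ℕ) : ℝ) ≤ 2 * a * K⁻¹ + 3 := by
    have := (Nat.ceil_lt_add_one (div_nonneg ha hK.le)).le
    push_cast
    rw [div_eq_mul_inv] at this ⊢
    linarith
  have hK' : 0 ≤ K⁻¹ ^ d := by positivity
  calc ((2 * ⌈a / K⌉₊ + 1 : ℕ) : ℝ) ^ d ≤ (2 * a * K⁻¹ + 3) ^ d := by gcongr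
    _ ≤ 2 ^ (d - 1) * ((2 * a * K⁻¹) ^ d + 3 ^ d) := add_pow_le (by positivity) (by norm_num) d
    _ ≤ 2 ^ (d - 1) * (((2 * a) ^ d + 3 ^ d) * (K⁻¹ ^ d + 1)) := by
        gcongr
        rw [mul_pow]
        have : 0 ≤ (2 * a) ^ d := by positivity
        nlinarith [mul_nonneg (pow_nonneg (zero_le_three (α := ℝ)) d) hK']
    _ = _ := by ring

/-- The boundary of a finite union of cubes inside a ball is a union of boundedly many Lipschitz
surfaces. -/
theorem exists_lipschitzSurface_cover (m : ℕ) :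
    ∃ C L : ℝ, 0 < C ∧ 0 ≤ L ∧
      ∀ (K : ℝ), 0 < K → ∀ (c : Euc (m + 1)) (R : ℝ), 0 < R →
      ∀ (𝒬 : Finset (Set (Euc (m + 1)))),
        (∀ Q ∈ 𝒬, ∃ l, IsCubeOfSide (m + 1) l Q ∧ K * Metric.diam (Metric.ball c R) ≤ l) →
        ∃ (n : ℕ) (S : Fin n → Set (Euc (m + 1))), (n : ℝ) ≤ C * (K⁻¹ ^ (m + 1) + 1) ∧
            (∀ i, IsLipschitzSurface (m + 1) L (S i)) ∧
            frontier (⋃₀ ↑𝒬) ∩ Metric.ball c R = ⋃ i, S i := by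
  have hd : (0 : ℝ) < (m + 1 : ℕ) := by positivity
  set s := √((m + 1 : ℕ) : ℝ)
  have hs0 : 0 < s := Real.sqrt_pos.2 hd
  obtain ⟨t, ht1, ht⟩ := exists_finset_net_sphere (m + 1) (δ := 1 / (2 * s)) (by positivity)
  refine ⟨(t.card + 1) * (2 ^ (m + 1 - 1) * ((2 * (2 * s)) ^ (m + 1) + 3 ^ (m + 1))),
    8 * (m + 1 : ℕ), by positivity, by positivity, ?_⟩
  intro K hK c R hR 𝒬 h𝒬
  rw [Metric.diam_ball_eq c hR.le] at h𝒬
  set E := ⋃₀ (𝒬 : Set (Set (Euc (m + 1))))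
  have hEo : IsOpen E := isOpen_sUnion fun Q hQ => by
    obtain ⟨l, hl, -⟩ := h𝒬 Q hQ
    exact hl.isOpen
  set h := R / (2 * s / K) with hh
  have hh0 : 0 < h := by positivity
  have hRh : R / h = 2 * s / K := by rw [hh]; field_simp
  have hmesh : h * s < K * R := by
    have : h * s = K * R / 2 := by rw [hh]; field_simp
    rw [this]
    exact half_lt_self (by positivity)
  set N := ⌈2 * s / K⌉₊
  let ι := t × (Fin (m + 1) → Finset.Icc (-(N : ℤ)) N)
  let S : ι → Set (Euc (m + 1)) := fun j =>
    {x | x ∈ frontier E ∩ ball c R ∧ (∀ i, ⌊(x i - c i) / h⌋ = j.2 i) ∧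
      ∀ y, dist y x < K * R →
        (1 - 1 / (8 * (m + 1 : ℕ))) * ‖y - x‖ < inner ℝ (y - x) j.1.1 → y ∈ E}
  refine ⟨Fintype.card ι, S ∘ (Fintype.equivFin ι).symm, ?_, fun i => ?_, ?_⟩
  · have hcard : Fintype.card ι = t.card * (2 * N + 1) ^ (m + 1) := by
      simp only [ι, Fintype.card_prod, Fintype.card_coe, Fintype.card_fun, Fintype.card_fin,
        Int.card_Icc]
      congr 2
      omega
    have h1 := grid_card_le (d := m + 1) (a := 2 * s) (by positivity) hK
    rw [hcard, Nat.cast_mul, Nat.cast_pow, mul_assoc]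
    gcongr
    linarith
  · set j := (Fintype.equivFin ι).symm i
    have hmR : (1 : ℝ) ≤ 8 * (m + 1 : ℕ) := by push_cast; linarith [(m.cast_nonneg : (0 : ℝ) ≤ m)]
    refine isLipschitzSurface_of_inner_le (S j) j.1.1 (ht1 _ j.1.2) hmR fun x hx y hy => ?_
    by_contra! hlt
    have hdist : dist y x < K * R :=
      (dist_le_of_floor_eq hh0 fun i => (hy.2.1 i).trans (hx.2.1 i).symm).trans_lt hmesh
    have hyE := hx.2.2 y hdist hlt
    have hyF := hy.1.1
    rw [hEo.frontier_eq] at hyF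
    exact hyF.2 hyE
  · simp only [Function.comp_apply]
    rw [(Fintype.equivFin ι).symm.surjective.iUnion_comp S]
    refine Subset.antisymm (fun x hx => ?_) (iUnion_subset fun j x hx => hx.1)
    obtain ⟨n, hn, hcone⟩ := exists_cone_of_mem_frontier (ρ := K * R) m.succ_pos ht1 ht
      𝒬.finite_toSet (fun Q hQ => by
        obtain ⟨l, hl, hle⟩ := h𝒬 Q hQ
        exact ⟨l, hl, by linarith⟩) hx.1
    have hfl := fun i => floor_mem_Icc_of_mem_ball hh0 hx.2 i
    rw [hRh] at hfl
    exact mem_iUnion.2 ⟨(⟨n, hn⟩, fun i => ⟨_, hfl i⟩), hx, fun i => rfl, hcone⟩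

/-- there are constants `C_d` and `L_d` such that for every `K > 0`,
every ball `B` and every finite set `𝒬` of cubes of side length at least `K diam(B)`,
the set `∂(⋃𝒬) ∩ B` is the union of at most `C_d (K^{-d} + 1)` Lipschitz surfaces with
constant `L_d`, and `H^{d-1}(∂(⋃𝒬) ∩ B) ≤ C_d (K^{-d} + 1) H^{d-1}(∂B)`. -/
theorem stmt8 (d : ℕ) (hd : 1 ≤ d) :
    ∃ C L : ℝ, 0 < C ∧ 0 ≤ L ∧
      ∀ (K : ℝ), 0 < K → ∀ (c : Euc d) (R : ℝ), 0 < R →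
      ∀ (𝒬 : Finset (Set (Euc d))),
        (∀ Q ∈ 𝒬, ∃ l, IsCubeOfSide d l Q ∧ K * Metric.diam (Metric.ball c R) ≤ l) →
        (∃ (n : ℕ) (S : Fin n → Set (Euc d)), (n : ℝ) ≤ C * (K⁻¹ ^ d + 1) ∧
            (∀ i, IsLipschitzSurface d L (S i)) ∧
            frontier (⋃₀ ↑𝒬) ∩ Metric.ball c R = ⋃ i, S i) ∧
        μH[(d:ℝ)-1] (frontier (⋃₀ ↑𝒬) ∩ Metric.ball c R) ≤
          ENNReal.ofReal (C * (K⁻¹ ^ d + 1)) *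
            μH[(d:ℝ)-1] (frontier (Metric.ball c R)) := by
  obtain ⟨m, rfl⟩ := Nat.exists_eq_add_of_le' hd
  obtain ⟨C, L, hC, hL, h⟩ := exists_lipschitzSurface_cover m
  have hL1 : 1 ≤ (1 + L) ^ m := one_le_pow₀ (by linarith)
  refine ⟨C * (1 + L) ^ m, L, by positivity, hL, fun K hK c R hR 𝒬 h𝒬 => ?_⟩
  obtain ⟨n, S, hn, hS, hU⟩ := h K hK c R hR 𝒬 h𝒬
  have hKp : 0 ≤ C * (K⁻¹ ^ (m + 1) + 1) := by positivity
  refine ⟨⟨n, S, hn.trans ?_, hS, hU⟩, ?_⟩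
  · nlinarith
  · have hm : (((m + 1 : ℕ) : ℝ) - 1) = m := by push_cast; ring
    rw [hm, frontier_ball c hR.ne']
    calc μH[(m : ℝ)] (frontier (⋃₀ ↑𝒬) ∩ ball c R) = μH[(m : ℝ)] (⋃ i, S i) := by rw [hU]
      _ ≤ ∑ i, μH[(m : ℝ)] (S i) := measure_iUnion_fintype_le _ _
      _ ≤ ∑ _i : Fin n, ENNReal.ofReal ((1 + L) ^ m) * μH[(m : ℝ)] (sphere c R) := by
          refine Finset.sum_le_sum fun i _ => (hS i).hausdorffMeasure_le hL ?_
          exact (subset_iUnion S i).trans (hU ▸ inter_subset_right)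
      _ = ENNReal.ofReal (n * (1 + L) ^ m) * μH[(m : ℝ)] (sphere c R) := by
          rw [Finset.sum_const, Finset.card_univ, Fintype.card_fin, nsmul_eq_mul,
            ENNReal.ofReal_mul n.cast_nonneg, ENNReal.ofReal_natCast, mul_assoc]
      _ ≤ _ := by
          gcongr ENNReal.ofReal ?_ * _
          calc (n : ℝ) * (1 + L) ^ m ≤ C * (K⁻¹ ^ (m + 1) + 1) * (1 + L) ^ m := by gcongr
            _ = _ := by ring
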